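/- arXiv:math/0203295 — 5 statements merged into one kernel-verified Lean document; each statement's English description precedes it below -/
import Mathlib

section
/- Let G be a finite group with subgroups H₁ and H₂ such that each conjugacy class of G intersects H₁ and H₂ in the same number of elements. Let k be a field of characteristic zero and let V be a k-linear representation of G. Then there exists a k-linear isomorphism i : V^{H₁} → V^{H₂} between the subspaces of H₁-invariants and H₂-invariants such that for every k-linear endomorphism Δ of V commuting with the action of G, one has i ∘ Δ = Δ ∘ i on V^{H₁} (note that Δ preserves both invariant subspaces). -/
/-- The Gassmann condition: each conjugacy class of `G` intersects `H₁` and `H₂`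
in the same number of elements. -/
def Gassmann {G : Type*} [Group G] (H₁ H₂ : Subgroup G) : Prop :=
  ∀ g : G, Nat.card {x : G // IsConj g x ∧ x ∈ H₁} =
    Nat.card {x : G // IsConj g x ∧ x ∈ H₂}

/-- The submodule of `H`-invariants of a representation `ρ` of `G`, for `H ≤ G`. -/
def repInvariants {k G V : Type*} [CommRing k] [Group G] [AddCommGroup V] [Module k V]
    (ρ : Representation k G V) (H : Subgroup G) : Submodule k V where
  carrier := {v | ∀ h ∈ H, ρ h v = v}
  add_mem' := by intro a b ha hb h hh; simp [map_add, ha h hh, hb h hh]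
  zero_mem' := by intro h hh; simp
  smul_mem' := by intro c v hv h hh; simp [map_smul, hv h hh]

open Module

universe u

theorem Module.Finite.linearMap_of_algebra (k A M N : Type*) [Field k] [Ring A] [Algebra k A]
    [AddCommGroup M] [Module k M] [Module A M] [IsScalarTower k A M] [Module.Finite k M]
    [AddCommGroup N] [Module k N] [Module A N] [IsScalarTower k A N] [Module.Finite k N] :
    Module.Finite k (M →ₗ[A] N) :=
  Module.Finite.of_injective (LinearMap.restrictScalarsₗ k A M N k)
    (LinearMap.restrictScalars_injective k)

/-- Finite-dimensional modules over a semisimple algebra are determined up to isomorphism by the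
dimensions of the spaces of homomorphisms out of them. -/
theorem IsSemisimpleRing.nonempty_linearEquiv_of_finrank_hom_eq
    {k A : Type*} [Field k] [Ring A] [Algebra k A] [IsSemisimpleRing A]
    (M N : Type u) [AddCommGroup M] [Module k M] [Module A M] [IsScalarTower k A M]
    [Module.Finite k M] [AddCommGroup N] [Module k N] [Module A N] [IsScalarTower k A N]
    [Module.Finite k N]
    (hMN : ∀ (W : Type u) [AddCommGroup W] [Module k W] [Module A W] [IsScalarTower k A W]
      [Module.Finite k W], finrank k (M →ₗ[A] W) = finrank k (N →ₗ[A] W)) :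
    Nonempty (M ≃ₗ[A] N) := by
  induction hn : finrank k M using Nat.strong_induction_on generalizing M N with
  | _ n ih =>
  rcases subsingleton_or_nontrivial M with hM | hM
  · have hfin := Module.Finite.linearMap_of_algebra k A N N
    have hzero : finrank k (N →ₗ[A] N) = 0 := by
      rw [← hMN N]
      exact finrank_zero_of_subsingleton
    have hsub : Subsingleton (N →ₗ[A] N) := finrank_zero_iff.mp hzero
    have hN : Subsingleton N :=
      subsingleton_of_forall_eq 0 fun x =>
        LinearMap.congr_fun (Subsingleton.elim (LinearMap.id : N →ₗ[A] N) 0) x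
    exact ⟨0⟩
  · obtain ⟨S, hS⟩ := IsSemisimpleModule.exists_simple_submodule A M
    obtain ⟨M', hM'⟩ := exists_isCompl S
    have finS : Module.Finite k S :=
      inferInstanceAs (Module.Finite k (S.restrictScalars k))
    have finM' : Module.Finite k M' :=
      inferInstanceAs (Module.Finite k (M'.restrictScalars k))
    have hfin₁ := Module.Finite.linearMap_of_algebra k A M S
    have hfin₂ := Module.Finite.linearMap_of_algebra k A N S
    have hSnt : Nontrivial S := IsSimpleModule.nontrivial A S
    obtain ⟨p, hp⟩ := IsSemisimpleModule.extension_property S.subtype S.injective_subtype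
      (LinearMap.id : S →ₗ[A] S)
    have hp0 : p ≠ 0 := by
      rintro rfl
      obtain ⟨s, hs⟩ := exists_ne (0 : S)
      exact hs (LinearMap.congr_fun hp s).symm
    have hnt : Nontrivial (M →ₗ[A] S) := ⟨⟨p, 0, hp0⟩⟩
    have hntN : Nontrivial (N →ₗ[A] S) := by
      rw [← finrank_pos_iff (R := k), ← hMN S]
      exact finrank_pos
    obtain ⟨f, hf⟩ := exists_ne (0 : N →ₗ[A] S)
    obtain ⟨C, hC⟩ := exists_isCompl (LinearMap.ker f)
    have finN' : Module.Finite k (LinearMap.ker f) :=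
      inferInstanceAs (Module.Finite k ((LinearMap.ker f).restrictScalars k))
    let eC : C ≃ₗ[A] S := (Submodule.quotientEquivOfIsCompl _ _ hC).symm ≪≫ₗ
      f.quotKerEquivOfSurjective (LinearMap.surjective_of_ne_zero hf)
    let eM : (S × M') ≃ₗ[A] M := Submodule.prodEquivOfIsCompl S M' hM'
    let eN : (S × LinearMap.ker f) ≃ₗ[A] N :=
      (eC.symm.prodCongr (LinearEquiv.refl A _)) ≪≫ₗ Submodule.prodEquivOfIsCompl _ _ hC.symm
    have hlt : finrank k M' < n := by
      have h := (eM.restrictScalars k).finrank_eq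
      rw [finrank_prod] at h
      have : 0 < finrank k S := finrank_pos
      omega
    obtain ⟨e⟩ := ih _ hlt M' (LinearMap.ker f) (fun W _ _ _ _ _ => by
      have := Module.Finite.linearMap_of_algebra k A S W
      have := Module.Finite.linearMap_of_algebra k A M' W
      have := Module.Finite.linearMap_of_algebra k A (LinearMap.ker f) W
      have h₁ := (LinearMap.coprodEquiv k ≪≫ₗ LinearEquiv.congrLeft W k eM).finrank_eq
      have h₂ := (LinearMap.coprodEquiv k ≪≫ₗ LinearEquiv.congrLeft W k eN).finrank_eq
      rw [finrank_prod] at h₁ h₂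
      have := hMN W
      omega) rfl
    exact ⟨eM.symm ≪≫ₗ (LinearEquiv.refl A S).prodCongr e ≪≫ₗ eN⟩

/-- Homomorphisms out of the left ideal generated by an idempotent `e` are given by
the elements fixed by `e`. -/
noncomputable def IsIdempotentElem.spanHomEquiv (k : Type*) {A W : Type*} [Field k] [Ring A]
    [Algebra k A] [AddCommGroup W] [Module k W] [Module A W] [IsScalarTower k A W]
    {e : A} (he : IsIdempotentElem e) :
    (Submodule.span A {e} →ₗ[A] W) ≃ₗ[k] LinearMap.range (Algebra.lsmul k k W e) where
  toFun f := ⟨f ⟨e, Submodule.mem_span_singleton_self e⟩,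
    f ⟨e, Submodule.mem_span_singleton_self e⟩,
    (map_smul f e _).symm.trans (congrArg f (Subtype.ext he))⟩
  map_add' _ _ := rfl
  map_smul' _ _ := rfl
  invFun w := (LinearMap.toSpanSingleton A W w).domRestrict _
  left_inv f := by
    ext ⟨x, hx⟩
    obtain ⟨a, rfl⟩ := Submodule.mem_span_singleton.mp hx
    simp only [LinearMap.domRestrict_apply, LinearMap.toSpanSingleton_apply]
    rw [← map_smul]
    refine congrArg f (Subtype.ext ?_)
    simp [mul_assoc, he.eq]
  right_inv := by
    rintro ⟨_, w, rfl⟩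
    ext
    simp [smul_smul, he.eq]

theorem IsIdempotentElem.trace_lsmul_eq_finrank (k : Type*) {A : Type*} (W : Type*) [Field k]
    [Ring A] [Algebra k A] [AddCommGroup W] [Module k W] [Module A W] [IsScalarTower k A W]
    [Module.Finite k W] {e : A} (he : IsIdempotentElem e) :
    LinearMap.trace k W (Algebra.lsmul k k W e) = finrank k (Submodule.span A {e} →ₗ[A] W) := by
  rw [(he.spanHomEquiv k).finrank_eq]
  exact (LinearMap.IsIdempotentElem.isProj_range _ (he.map (Algebra.lsmul k k W))).trace

/-- Two idempotents of a semisimple algebra in characteristic zero which are not separated by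
trace functions are Murray–von Neumann equivalent. -/
theorem IsSemisimpleRing.exists_mul_eq_of_trace_eq
    {k : Type*} {A : Type u} [Field k] [CharZero k] [Ring A] [Algebra k A] [IsSemisimpleRing A]
    [Module.Finite k A] {e₁ e₂ : A} (he₁ : IsIdempotentElem e₁) (he₂ : IsIdempotentElem e₂)
    (h : ∀ φ : A →ₗ[k] k, (∀ a b, φ (a * b) = φ (b * a)) → φ e₁ = φ e₂) :
    ∃ x y : A, x * y = e₁ ∧ y * x = e₂ ∧ e₁ * x = x ∧ e₂ * y = y := by
  have fin₁ : Module.Finite k (Submodule.span A {e₁}) :=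
    inferInstanceAs (Module.Finite k ((Submodule.span A {e₁}).restrictScalars k))
  have fin₂ : Module.Finite k (Submodule.span A {e₂}) :=
    inferInstanceAs (Module.Finite k ((Submodule.span A {e₂}).restrictScalars k))
  obtain ⟨θ⟩ := IsSemisimpleRing.nonempty_linearEquiv_of_finrank_hom_eq (k := k) (A := A)
    (Submodule.span A {e₁}) (Submodule.span A {e₂}) (fun W _ _ _ _ _ => by
      have htr := h (LinearMap.trace k W ∘ₗ (Algebra.lsmul k k W).toLinearMap) (fun a b => by
        simp only [LinearMap.comp_apply, AlgHom.toLinearMap_apply, map_mul]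
        exact LinearMap.trace_mul_comm k _ _)
      simp only [LinearMap.comp_apply, AlgHom.toLinearMap_apply,
        he₁.trace_lsmul_eq_finrank k W, he₂.trace_lsmul_eq_finrank k W] at htr
      exact_mod_cast htr)
  have fixed {e : A} (he : IsIdempotentElem e) (z : Submodule.span A {e}) : (z : A) * e = z := by
    obtain ⟨z, hz⟩ := z
    obtain ⟨a, rfl⟩ := Submodule.mem_span_singleton.mp hz
    simp [mul_assoc, he.eq]
  let g₁ : Submodule.span A {e₁} := ⟨e₁, Submodule.mem_span_singleton_self e₁⟩
  let g₂ : Submodule.span A {e₂} := ⟨e₂, Submodule.mem_span_singleton_self e₂⟩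
  have hg₁ : e₁ • g₁ = g₁ := Subtype.ext he₁
  have hg₂ : e₂ • g₂ = g₂ := Subtype.ext he₂
  have hx : (θ g₁ : A) • g₂ = θ g₁ := Subtype.ext (fixed he₂ _)
  have hy : (θ.symm g₂ : A) • g₁ = θ.symm g₂ := Subtype.ext (fixed he₁ _)
  refine ⟨θ g₁, θ.symm g₂, ?_, ?_, ?_, ?_⟩
  · have := congrArg θ.symm hx
    rw [map_smul, θ.symm_apply_apply] at this
    exact congrArg Subtype.val this
  · have := congrArg θ hy
    rw [map_smul, θ.apply_symm_apply] at this
    exact congrArg Subtype.val this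
  · have := congrArg θ hg₁
    rw [map_smul] at this
    exact congrArg Subtype.val this
  · have := congrArg θ.symm hg₂
    rw [map_smul] at this
    exact congrArg Subtype.val this

theorem Gassmann.exists_equiv_isConj {G : Type*} [Group G] [Finite G] {H₁ H₂ : Subgroup G}
    (hG : Gassmann H₁ H₂) : ∃ σ : H₁ ≃ H₂, ∀ h : H₁, IsConj (h : G) (σ h) := by
  have fiber (H : Subgroup G) (g : G) :
      Nonempty ({x : H // ConjClasses.mk (x : G) = ConjClasses.mk g} ≃
        {x : G // IsConj g x ∧ x ∈ H}) :=
    ⟨{ toFun := fun x => ⟨x.1, (ConjClasses.mk_eq_mk_iff_isConj.mp x.2).symm, x.1.2⟩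
       invFun := fun x => ⟨⟨x.1, x.2.2⟩, ConjClasses.mk_eq_mk_iff_isConj.mpr x.2.1.symm⟩
       left_inv := fun _ => rfl
       right_inv := fun _ => rfl }⟩
  have match_fibers (c : ConjClasses G) : Nonempty
      ({x : H₁ // ConjClasses.mk (x : G) = c} ≃ {x : H₂ // ConjClasses.mk (x : G) = c}) := by
    induction c using Quotient.inductionOn with
    | h g =>
      obtain ⟨α⟩ := fiber H₁ g
      obtain ⟨β⟩ := fiber H₂ g
      exact ⟨α.trans ((Finite.card_eq.mp (hG g)).some.trans β.symm)⟩
  let τ := fun c => (match_fibers c).some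
  refine ⟨(Equiv.sigmaFiberEquiv fun x : H₁ => ConjClasses.mk (x : G)).symm.trans
    ((Equiv.sigmaCongrRight τ).trans
      (Equiv.sigmaFiberEquiv fun x : H₂ => ConjClasses.mk (x : G))), fun h => ?_⟩
  exact (ConjClasses.mk_eq_mk_iff_isConj.mp (τ (ConjClasses.mk (h : G)) ⟨h, rfl⟩).2).symm

/-- The idempotent of the group algebra which averages over a subgroup. -/
noncomputable def Subgroup.averageElem (k : Type*) {G : Type*} [Field k] [Group G] [Finite G]
    (H : Subgroup G) : MonoidAlgebra k G :=
  letI := Fintype.ofFinite H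
  (Nat.card H : k)⁻¹ • ∑ h : H, MonoidAlgebra.of k G h

section averageElem

variable {k G V : Type*} [Field k] [Group G] [Finite G] [AddCommGroup V] [Module k V]

theorem Subgroup.of_mul_averageElem (H : Subgroup G) {g : G} (hg : g ∈ H) :
    MonoidAlgebra.of k G g * H.averageElem k = H.averageElem k := by
  let := Fintype.ofFinite H
  rw [Subgroup.averageElem, mul_smul_comm, Finset.mul_sum]
  congr 1
  simp_rw [← map_mul]
  exact Equiv.sum_comp (Equiv.mulLeft (⟨g, hg⟩ : H)) fun h : H => MonoidAlgebra.of k G (h : G)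

theorem Subgroup.isIdempotentElem_averageElem [CharZero k] (H : Subgroup G) :
    IsIdempotentElem (H.averageElem k) := by
  let := Fintype.ofFinite H
  have hcard : (Nat.card H : k) ≠ 0 := Nat.cast_ne_zero.mpr Nat.card_pos.ne'
  rw [IsIdempotentElem]
  conv_lhs => enter [1]; rw [Subgroup.averageElem]
  rw [smul_mul_assoc, Finset.sum_mul,
    Finset.sum_congr rfl fun h _ => H.of_mul_averageElem (k := k) h.2, Finset.sum_const,
    Finset.card_univ, ← Nat.card_eq_fintype_card, ← Nat.cast_smul_eq_nsmul k, smul_smul,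
    inv_mul_cancel₀ hcard, one_smul]

theorem mem_repInvariants_iff_averageElem [CharZero k] (ρ : Representation k G V)
    (H : Subgroup G) (v : V) :
    v ∈ repInvariants ρ H ↔ ρ.asAlgebraHom (H.averageElem k) v = v := by
  let := Fintype.ofFinite H
  have hcard : (Nat.card H : k) ≠ 0 := Nat.cast_ne_zero.mpr Nat.card_pos.ne'
  constructor
  · intro hv
    simp only [Subgroup.averageElem, map_smul, map_sum, LinearMap.smul_apply, LinearMap.sum_apply,
      Representation.asAlgebraHom_of]
    rw [Finset.sum_congr rfl fun (h : H) _ => hv h h.2, Finset.sum_const, Finset.card_univ,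
      ← Nat.card_eq_fintype_card, ← Nat.cast_smul_eq_nsmul k, smul_smul, inv_mul_cancel₀ hcard,
      one_smul]
  · intro hv h hh
    rw [← hv, ← Representation.asAlgebraHom_of ρ, ← Module.End.mul_apply, ← map_mul,
      H.of_mul_averageElem hh]

theorem Gassmann.apply_averageElem_eq {H₁ H₂ : Subgroup G} (hG : Gassmann H₁ H₂)
    (φ : MonoidAlgebra k G →ₗ[k] k) (hφ : ∀ a b, φ (a * b) = φ (b * a)) :
    φ (H₁.averageElem k) = φ (H₂.averageElem k) := by
  let := Fintype.ofFinite H₁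
  let := Fintype.ofFinite H₂
  obtain ⟨σ, hσ⟩ := hG.exists_equiv_isConj
  simp only [Subgroup.averageElem, map_smul, map_sum, Nat.card_congr σ]
  rw [← Equiv.sum_comp σ]
  congr 1
  refine Finset.sum_congr rfl fun h _ => ?_
  obtain ⟨c, hc⟩ := isConj_iff.mp (hσ h)
  rw [← hc, map_mul, hφ, ← map_mul]
  simp

end averageElem

theorem Representation.comp_asAlgebraHom_of_commute {k G V : Type*} [CommRing k] [Group G]
    [AddCommGroup V] [Module k V] (ρ : Representation k G V) {Δ : V →ₗ[k] V}
    (hΔ : ∀ g : G, Δ ∘ₗ ρ g = ρ g ∘ₗ Δ) (a : MonoidAlgebra k G) (v : V) :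
    ρ.asAlgebraHom a (Δ v) = Δ (ρ.asAlgebraHom a v) := by
  induction a using MonoidAlgebra.induction_on with
  | of g =>
    rw [Representation.asAlgebraHom_of]
    exact (LinearMap.congr_fun (hΔ g) v).symm
  | add a b ha hb => simp [ha, hb]
  | smul r a ha => simp [ha]

theorem stmt0 {k G V : Type*} [Field k] [CharZero k] [Group G] [Finite G]
    [AddCommGroup V] [Module k V] (ρ : Representation k G V)
    (H₁ H₂ : Subgroup G) (hG : Gassmann H₁ H₂) :
    ∃ i : (repInvariants ρ H₁) ≃ₗ[k] (repInvariants ρ H₂),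
      ∀ (Δ : V →ₗ[k] V), (∀ g : G, Δ ∘ₗ ρ g = ρ g ∘ₗ Δ) →
        ∀ (v : V) (hv : v ∈ repInvariants ρ H₁) (hv' : Δ v ∈ repInvariants ρ H₁),
          (i ⟨Δ v, hv'⟩ : V) = Δ (i ⟨v, hv⟩) := by
  obtain ⟨x, y, hxy, hyx, hx, hy⟩ := IsSemisimpleRing.exists_mul_eq_of_trace_eq (k := k)
    (H₁.isIdempotentElem_averageElem (k := k)) (H₂.isIdempotentElem_averageElem (k := k))
    hG.apply_averageElem_eq
  have maps_to {H : Subgroup G} {z : MonoidAlgebra k G} (hz : H.averageElem k * z = z) (v : V) :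
      ρ.asAlgebraHom z v ∈ repInvariants ρ H := by
    rw [mem_repInvariants_iff_averageElem, ← Module.End.mul_apply, ← map_mul, hz]
  refine ⟨LinearEquiv.ofLinearMap
    ((ρ.asAlgebraHom y).restrict fun v _ => maps_to hy v)
    ((ρ.asAlgebraHom x).restrict fun v _ => maps_to hx v) ?_ ?_, ?_⟩
  · ext ⟨v, hv⟩
    change ρ.asAlgebraHom y (ρ.asAlgebraHom x v) = v
    rw [← Module.End.mul_apply, ← map_mul, hyx, (mem_repInvariants_iff_averageElem ρ H₂ v).mp hv]
  · ext ⟨v, hv⟩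
    change ρ.asAlgebraHom x (ρ.asAlgebraHom y v) = v
    rw [← Module.End.mul_apply, ← map_mul, hxy, (mem_repInvariants_iff_averageElem ρ H₁ v).mp hv]
  · intro Δ hΔ v _ _
    exact ρ.comp_asAlgebraHom_of_commute hΔ y v
end

section
/- Let G be a finite group, H a subgroup of G, and g ∈ G. Then the number of fixed points of g acting on the coset space G/H, multiplied by the order of H, equals the order of the centralizer of g in G multiplied by the number of elements of H that are conjugate in G to g; that is, |{xH ∈ G/H : gxH = xH}| · |H| = |Z_G(g)| · |{h ∈ H : h is G-conjugate to g}|. -/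
/-- The elements of `G` conjugating `g` into `H` form a union of left cosets of `H`, namely those
fixed by `g`. -/
theorem card_fixedCosets_mul_card {G : Type*} [Group G] (H : Subgroup G) (g : G) :
    Nat.card {x : G ⧸ H // g • x = x} * Nat.card H = Nat.card {x : G // x⁻¹ * g * x ∈ H} := by
  have h := QuotientGroup.card_preimage_mk H {x : G ⧸ H | g • x = x}
  rw [mul_comm]
  refine h.symm.trans (Nat.card_congr (Equiv.subtypeEquivRight fun x => ?_))
  change g • (x : G ⧸ H) = x ↔ _
  rw [MulAction.Quotient.smul_coe, eq_comm, QuotientGroup.eq, smul_eq_mul, mul_assoc]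

/-- An element conjugating `g` into `H` amounts to a conjugate `h ∈ H` of `g` together with an
element of the centralizer of `g`, once an element conjugating `g` to each `h` is chosen. -/
theorem card_conj_mem_eq {G : Type*} [Group G] (H : Subgroup G) (g : G) :
    Nat.card {x : G // x⁻¹ * g * x ∈ H} =
      Nat.card (Subgroup.centralizer {g}) * Nat.card {h : G // h ∈ H ∧ IsConj g h} := by
  have hex (h : {h : G // h ∈ H ∧ IsConj g h}) : ∃ c : G, c * g * c⁻¹ = h :=
    isConj_iff.mp h.2.2
  choose c hc using hex
  have hconj (x : {x : G // x⁻¹ * g * x ∈ H}) : IsConj g (x.1⁻¹ * g * x.1) :=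
    isConj_iff.mpr ⟨x.1⁻¹, by rw [inv_inv]⟩
  have hmul (z : Subgroup.centralizer {g}) (h : {h : G // h ∈ H ∧ IsConj g h}) :
      (z.1 * (c h)⁻¹)⁻¹ * g * (z.1 * (c h)⁻¹) = h := by
    have hz := Subgroup.mem_centralizer_singleton_iff.mp z.2
    calc _ = c h * (z.1⁻¹ * (g * z.1)) * (c h)⁻¹ := by group
      _ = h := by rw [← hz, inv_mul_cancel_left, hc]
  rw [← Nat.card_prod]
  refine Nat.card_congr
    { toFun x := (⟨x.1 * c ⟨_, x.2, hconj x⟩, ?_⟩, ⟨_, x.2, hconj x⟩)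
      invFun p := ⟨p.1.1 * (c p.2)⁻¹, by rw [hmul]; exact p.2.2.1⟩
      left_inv x := by simp
      right_inv p := ?_ }
  · rw [Subgroup.mem_centralizer_singleton_iff]
    have h := hc ⟨_, x.2, hconj x⟩
    rw [mul_inv_eq_iff_eq_mul] at h
    rw [mul_assoc, h]
    group
  · obtain ⟨z, h⟩ := p
    have key : ∀ k : {h : G // h ∈ H ∧ IsConj g h}, k = h → z.1 * (c h)⁻¹ * c k = z := by
      rintro k rfl
      simp
    exact Prod.ext (Subtype.ext (key _ (Subtype.ext (hmul z h)))) (Subtype.ext (hmul z h))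

theorem stmt4 {G : Type*} [Group G] [Finite G] (H : Subgroup G) (g : G) :
    Nat.card {x : G ⧸ H // g • x = x} * Nat.card H =
      Nat.card (Subgroup.centralizer {g}) * Nat.card {h : G // h ∈ H ∧ IsConj g h} := by
  rw [card_fixedCosets_mul_card, card_conj_mem_eq]
end

section
/- Let G be a finite group with subgroups H₁ and H₂ such that each conjugacy class of G intersects H₁ and H₂ in the same number of elements. Then for every g ∈ G, the number of fixed points of g acting on the coset space G/H₁ equals the number of fixed points of g acting on G/H₂. -/
theorem Gassmann.card_eq {G : Type*} [Group G] [Finite G] {H₁ H₂ : Subgroup G}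
    (hG : Gassmann H₁ H₂) : Nat.card H₁ = Nat.card H₂ := by
  classical
  have := Fintype.ofFinite (ConjClasses G)
  have card_eq_sum (H : Subgroup G) : Nat.card H =
      ∑ c : ConjClasses G, Nat.card {x : H // ConjClasses.mk (x : G) = c} := by
    rw [← Nat.card_sigma]
    exact Nat.card_congr (Equiv.sigmaFiberEquiv fun x : H => ConjClasses.mk (x : G)).symm
  have card_fiber (H : Subgroup G) (g : G) :
      Nat.card {x : H // ConjClasses.mk (x : G) = ConjClasses.mk g} =
        Nat.card {x : G // IsConj g x ∧ x ∈ H} :=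
    Nat.card_congr
      { toFun x := ⟨x.1, (ConjClasses.mk_eq_mk_iff_isConj.1 x.2).symm, x.1.2⟩
        invFun x := ⟨⟨x.1, x.2.2⟩, ConjClasses.mk_eq_mk_iff_isConj.2 x.2.1.symm⟩ }
  rw [card_eq_sum, card_eq_sum]
  refine Finset.sum_congr rfl fun c _ => ?_
  obtain ⟨g, rfl⟩ := ConjClasses.mk_surjective c
  rw [card_fiber, card_fiber, hG g]

theorem Subgroup.card_mul_card_fixed_quotient {G : Type*} [Group G] (H : Subgroup G) (g : G) :
    Nat.card H * Nat.card {x : G ⧸ H // g • x = x} =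
      Nat.card {x : G // x⁻¹ * g * x ∈ H} := by
  rw [← Nat.card_prod]
  refine Nat.card_congr ((QuotientGroup.preimageMkEquivSubgroupProdSet H
    {x : G ⧸ H | g • x = x}).symm.trans (Equiv.subtypeEquivRight fun x => ?_))
  change ((g * x : G) : G ⧸ H) = x ↔ _
  rw [eq_comm, QuotientGroup.eq, mul_assoc]

theorem Subgroup.card_conj_mem {G : Type*} [Group G] [Finite G] (H : Subgroup G) (g : G) :
    Nat.card {x : G // x⁻¹ * g * x ∈ H} =
      Nat.card {y : G // IsConj g y ∧ y ∈ H} * Nat.card {x : G // x⁻¹ * g * x = g} := by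
  classical
  let f (x : {x : G // x⁻¹ * g * x ∈ H}) : {y : G // IsConj g y ∧ y ∈ H} :=
    ⟨x.1⁻¹ * g * x.1, isConj_iff.2 ⟨x.1⁻¹, by simp⟩, x.2⟩
  have := Fintype.ofFinite {y : G // IsConj g y ∧ y ∈ H}
  rw [← Nat.card_congr (Equiv.sigmaFiberEquiv f), Nat.card_sigma,
    Finset.sum_congr rfl (g := fun _ => Nat.card {x : G // x⁻¹ * g * x = g}), Finset.sum_const,
    Finset.card_univ, Nat.card_eq_fintype_card (α := {y : G // IsConj g y ∧ y ∈ H}), smul_eq_mul]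
  rintro ⟨y, hy, hyH⟩ -
  obtain ⟨c, rfl⟩ := isConj_iff.1 hy
  refine Nat.card_congr
    { toFun x := ⟨x.1.1 * c, ?_⟩
      invFun x := ⟨⟨x.1 * c⁻¹, ?_⟩, Subtype.ext ?_⟩
      left_inv x := by simp
      right_inv x := by simp }
  · have h : x.1.1⁻¹ * g * x.1.1 = c * g * c⁻¹ := congrArg Subtype.val x.2
    calc (x.1.1 * c)⁻¹ * g * (x.1.1 * c) = c⁻¹ * (x.1.1⁻¹ * g * x.1.1) * c := by group
      _ = g := by rw [h]; group
  all_goals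
    have h : (x.1 * c⁻¹)⁻¹ * g * (x.1 * c⁻¹) = c * g * c⁻¹ := by
      calc _ = c * (x.1⁻¹ * g * x.1) * c⁻¹ := by group
        _ = _ := by rw [x.2]
  · rwa [h]
  · exact h

theorem stmt5 {G : Type*} [Group G] [Finite G] (H₁ H₂ : Subgroup G)
    (hG : Gassmann H₁ H₂) (g : G) :
    Nat.card {x : G ⧸ H₁ // g • x = x} = Nat.card {x : G ⧸ H₂ // g • x = x} := by
  refine Nat.eq_of_mul_eq_mul_left (Nat.card_pos (α := H₁)) ?_
  rw [H₁.card_mul_card_fixed_quotient, hG.card_eq, H₂.card_mul_card_fixed_quotient,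
    H₁.card_conj_mem, H₂.card_conj_mem, hG g]
end

section
/- Let G be a finite group with subgroups H₁ and H₂ such that each conjugacy class of G intersects H₁ and H₂ in the same number of elements. Let k be a field of characteristic zero, V a finite-dimensional k-linear representation of G, and Δ a k-linear endomorphism of V commuting with the action of G. Then for every λ ∈ k, the dimension of the λ-eigenspace of the restriction of Δ to V^{H₁} equals the dimension of the λ-eigenspace of the restriction of Δ to V^{H₂}; that is, dim_k {v ∈ V^{H₁} : Δv = λv} = dim_k {v ∈ V^{H₂} : Δv = λv}. -/
/-- Under the Gassmann condition, a class function has the same sum over both subgroups. -/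
lemma Gassmann.sum_eq {G M : Type*} [Group G] [Fintype G] [AddCommMonoid M]
    {H₁ H₂ : Subgroup G} [Fintype H₁] [Fintype H₂] (hG : Gassmann H₁ H₂) (f : G → M)
    (hf : ∀ x y, IsConj x y → f x = f y) :
    ∑ h : H₁, f h = ∑ h : H₂, f h := by
  classical
  choose rep hrep using ConjClasses.mk_surjective (α := G)
  have sum_eq_sum_classes (H : Subgroup G) [Fintype H] :
      ∑ h : H, f h = ∑ c : ConjClasses G,
        Nat.card {x : G // IsConj (rep c) x ∧ x ∈ H} • f (rep c) := by
    rw [← Finset.sum_fiberwise Finset.univ (fun h : H => ConjClasses.mk (h : G))]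
    refine Finset.sum_congr rfl fun c _ => ?_
    have hconj (x : G) : ConjClasses.mk x = c ↔ IsConj (rep c) x := by
      rw [← ConjClasses.mk_eq_mk_iff_isConj, hrep, eq_comm]
    have hconst : ∀ h ∈ Finset.univ.filter (fun h : H => ConjClasses.mk (h : G) = c),
        f h = f (rep c) :=
      fun h hh => (hf _ _ ((hconj h).1 (Finset.mem_filter.1 hh).2)).symm
    rw [Finset.sum_congr rfl hconst, Finset.sum_const]
    congr 1
    rw [← Fintype.card_subtype, ← Nat.card_eq_fintype_card]
    exact Nat.card_congr
      { toFun := fun h => ⟨h.1, (hconj _).1 h.2, h.1.2⟩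
        invFun := fun x => ⟨⟨x.1, x.2.2⟩, (hconj _).2 x.2.1⟩
        left_inv := fun _ => rfl
        right_inv := fun _ => rfl }
  rw [sum_eq_sum_classes H₁, sum_eq_sum_classes H₂]
  exact Finset.sum_congr rfl fun c _ => by rw [hG]

/-- The trace formula `|H| * dim V ^ H = ∑ h ∈ H, tr (ρ h)`. -/
lemma card_mul_finrank_repInvariants {k G V : Type*} [Field k] [CharZero k] [Group G]
    [AddCommGroup V] [Module k V] [FiniteDimensional k V]
    (ρ : Representation k G V) (H : Subgroup G) [Fintype H] :
    (Fintype.card H : k) * Module.finrank k (repInvariants ρ H) =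
      ∑ h : H, LinearMap.trace k V (ρ h) := by
  have hcard : (Fintype.card H : k) ≠ 0 := Nat.cast_ne_zero.2 Fintype.card_ne_zero
  let _ : Invertible (Fintype.card H : k) := invertibleOfNonzero hcard
  have hinv : repInvariants ρ H = Representation.invariants (ρ.comp H.subtype) := by
    ext v
    exact ⟨fun hv h => hv h h.2, fun hv h hh => hv ⟨h, hh⟩⟩
  rw [hinv, ← (Representation.isProj_averageMap (ρ.comp H.subtype)).trace]
  simp [Representation.averageMap, GroupAlgebra.average, map_sum, hcard]

/-- Gassmann equivalent subgroups have invariant subspaces of the same dimension. -/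
lemma Gassmann.finrank_repInvariants_eq {k G V : Type*} [Field k] [CharZero k] [Group G]
    [Finite G] [AddCommGroup V] [Module k V] [FiniteDimensional k V]
    (ρ : Representation k G V) {H₁ H₂ : Subgroup G} (hG : Gassmann H₁ H₂) :
    Module.finrank k (repInvariants ρ H₁) = Module.finrank k (repInvariants ρ H₂) := by
  let _ := Fintype.ofFinite G
  let _ := Fintype.ofFinite H₁
  let _ := Fintype.ofFinite H₂
  have hcard : Fintype.card H₁ = Fintype.card H₂ := by
    simpa using hG.sum_eq (fun _ => (1 : ℕ)) fun _ _ _ => rfl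
  have htrace := hG.sum_eq (fun g => LinearMap.trace k V (ρ g)) fun x y hxy => by
    obtain ⟨c, rfl⟩ := isConj_iff.1 hxy
    rw [map_mul, LinearMap.trace_mul_comm, ← map_mul, inv_mul_cancel_left]
  rw [← card_mul_finrank_repInvariants, ← card_mul_finrank_repInvariants, hcard] at htrace
  exact_mod_cast mul_left_cancel₀ (Nat.cast_ne_zero.2 Fintype.card_ne_zero) htrace

theorem stmt10 {k G V : Type*} [Field k] [CharZero k] [Group G] [Finite G]
    [AddCommGroup V] [Module k V] [FiniteDimensional k V]
    (ρ : Representation k G V) (H₁ H₂ : Subgroup G) (hG : Gassmann H₁ H₂)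
    (Δ : Module.End k V) (hΔ : ∀ g : G, Δ ∘ₗ ρ g = ρ g ∘ₗ Δ) (μ : k) :
    Module.finrank k ↥(repInvariants ρ H₁ ⊓ Module.End.eigenspace Δ μ) =
      Module.finrank k ↥(repInvariants ρ H₂ ⊓ Module.End.eigenspace Δ μ) := by
  have hmaps (g : G) : ∀ v ∈ Module.End.eigenspace Δ μ, ρ g v ∈ Module.End.eigenspace Δ μ := by
    intro v hv
    rw [Module.End.mem_eigenspace_iff] at hv ⊢
    rw [← LinearMap.comp_apply, hΔ, LinearMap.comp_apply, hv, map_smul]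
  let σ : Representation k G (Module.End.eigenspace Δ μ) :=
    { toFun := fun g => (ρ g).restrict (hmaps g)
      map_one' := by ext; simp
      map_mul' := fun g h => by ext; simp }
  have hcomap (H : Subgroup G) : Module.finrank k (repInvariants σ H) =
      Module.finrank k ↥(repInvariants ρ H ⊓ Module.End.eigenspace Δ μ) := by
    have hmap : (repInvariants σ H).map (Module.End.eigenspace Δ μ).subtype =
        repInvariants ρ H ⊓ Module.End.eigenspace Δ μ := by
      ext v
      constructor
      · rintro ⟨w, hw, rfl⟩
        exact ⟨fun h hh => congrArg Subtype.val (hw h hh), w.2⟩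
      · rintro ⟨hv, hvE⟩
        exact ⟨⟨v, hvE⟩, fun h hh => Subtype.ext (hv h hh), rfl⟩
    rw [← hmap]
    exact (Submodule.finrank_map_subtype_eq _ _).symm
  rw [← hcomap, ← hcomap]
  exact hG.finrank_repInvariants_eq σ
end

section
/- Let G be a finite group with subgroups H₁ and H₂ such that each conjugacy class of G intersects H₁ and H₂ in the same number of elements. Let k be a field of characteristic zero and V a finite-dimensional k-linear representation of G. Then the subspaces of invariants V^{H₁} and V^{H₂} have the same dimension over k. -/
/-- Subgroups satisfying the Gassmann condition admit a bijection that preserves conjugacy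
classes of the ambient group. -/
theorem Gassmann.exists_equiv {G : Type*} [Group G] [Finite G] {H₁ H₂ : Subgroup G}
    (hG : Gassmann H₁ H₂) : ∃ e : H₁ ≃ H₂, ∀ h : H₁, IsConj (e h : G) (h : G) := by
  have fiberEquiv (H : Subgroup G) (g : G) :
      Nonempty ({h : H // ConjClasses.mk (h : G) = ConjClasses.mk g} ≃
        {x : G // IsConj g x ∧ x ∈ H}) :=
    ⟨{ toFun := fun h => ⟨h.1, (ConjClasses.mk_eq_mk_iff_isConj.1 h.2).symm, h.1.2⟩
       invFun := fun x => ⟨⟨x.1, x.2.2⟩, ConjClasses.mk_eq_mk_iff_isConj.2 x.2.1.symm⟩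
       left_inv := fun _ => rfl
       right_inv := fun _ => rfl }⟩
  have key (c : ConjClasses G) : Nonempty
      ({h : H₁ // ConjClasses.mk (h : G) = c} ≃ {h : H₂ // ConjClasses.mk (h : G) = c}) := by
    obtain ⟨g, rfl⟩ := ConjClasses.mk_surjective c
    obtain ⟨e₁⟩ := fiberEquiv H₁ g
    obtain ⟨e₂⟩ := fiberEquiv H₂ g
    exact ⟨(e₁.trans (Finite.card_eq.1 (hG g)).some).trans e₂.symm⟩
  exact ⟨Equiv.ofFiberEquiv fun c => (key c).some, fun h =>
    ConjClasses.mk_eq_mk_iff_isConj.1 <|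
      Equiv.ofFiberEquiv_map (f := fun h : H₁ => ConjClasses.mk (h : G))
        (g := fun h : H₂ => ConjClasses.mk (h : G)) (fun c => (key c).some) h⟩

/-- The character of a representation takes equal values on conjugate elements. -/
theorem Representation.character_eq_of_isConj {k G V : Type*} [Field k] [Group G]
    [AddCommGroup V] [Module k V] (ρ : Representation k G V) {g h : G} (hgh : IsConj g h) :
    ρ.character g = ρ.character h := by
  obtain ⟨c, rfl⟩ := isConj_iff.1 hgh
  exact (ρ.char_conj g c).symm

/-- The dimension of the `H`-invariants is the average over `H` of the character. -/
theorem finrank_repInvariants {k G V : Type*} [Field k] [CharZero k] [Group G]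
    [AddCommGroup V] [Module k V] [FiniteDimensional k V]
    (ρ : Representation k G V) (H : Subgroup G) [Fintype H] :
    (Module.finrank k (repInvariants ρ H) : k) =
      (Nat.card H : k)⁻¹ * ∑ h : H, ρ.character (h : G) := by
  have : Invertible (Nat.card H : k) :=
    invertibleOfNonzero (Nat.cast_ne_zero.2 Nat.card_pos.ne')
  have hinv : repInvariants ρ H = Representation.invariants (ρ.comp H.subtype) := by
    ext v
    exact ⟨fun hv h => hv h h.2, fun hv h hh => hv ⟨h, hh⟩⟩
  rw [hinv, ← Representation.card_inv_mul_sum_char_eq_finrank]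
  rfl

theorem stmt12 {k G V : Type*} [Field k] [CharZero k] [Group G] [Finite G]
    [AddCommGroup V] [Module k V] [FiniteDimensional k V]
    (ρ : Representation k G V) (H₁ H₂ : Subgroup G) (hG : Gassmann H₁ H₂) :
    Module.finrank k (repInvariants ρ H₁) = Module.finrank k (repInvariants ρ H₂) := by
  have := Fintype.ofFinite H₁
  have := Fintype.ofFinite H₂
  obtain ⟨e, he⟩ := hG.exists_equiv
  apply Nat.cast_injective (R := k)
  rw [finrank_repInvariants, finrank_repInvariants, Nat.card_congr e]
  congr 1
  exact Fintype.sum_equiv e _ _ fun h => (ρ.character_eq_of_isConj (he h)).symm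
end
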